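/- For every c ∈ ℂ and every (x₀,x₁,x₂) ∈ ℂ³, one has the identity of vectors in ℂ⁴: g(x₀, c·x₁, x₀, 2c·x₂) = c²·x₀²·(U(c)·f(x₀,x₁,x₂)), where U(c) is the 4×4 matrix with rows (1,0,0,0), (1,4c⁵,0,0), (0,0,32c⁶,0), (0,0,32c⁶,4c). In particular, for every c ≠ 0 the projective transformation of ℙ³(ℂ) induced by U(c) maps each point [f(x)] with x₀x₁x₂ ≠ 0 to a point of the form [g(y)]. -/

import Mathlib

/-- The parametrization `f : ℂ³ → ℂ⁴` of the surface `X`. -/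
noncomputable def fB (x : Fin 3 → ℂ) : Fin 4 → ℂ :=
  ![x 0 ^ 6 * x 1 ^ 2, x 0 * x 1 ^ 5 * x 2 ^ 2, x 1 ^ 3 * x 2 ^ 5,
    x 0 ^ 5 * x 1 * x 2 ^ 2 + 2 * (x 0 ^ 5 * x 2 ^ 3)]

/-- The parametrization `g : ℂ⁴ → ℂ⁴` of the surface `Y`. -/
noncomputable def gB (y : Fin 4 → ℂ) : Fin 4 → ℂ :=
  ![y 0 ^ 3 * y 1 ^ 2 * y 2 ^ 5,
    y 0 ^ 3 * y 1 ^ 2 * y 2 ^ 5 + y 1 ^ 5 * y 2 ^ 3 * y 3 ^ 2,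
    y 0 ^ 2 * y 1 ^ 3 * y 3 ^ 5,
    y 0 ^ 4 * y 1 * y 2 ^ 3 * y 3 ^ 2 + y 0 ^ 5 * y 2 ^ 2 * y 3 ^ 3 +
      y 0 ^ 2 * y 1 ^ 3 * y 3 ^ 5]

/-- The family of matrices `U(c)`. -/
noncomputable def Umat (c : ℂ) : Matrix (Fin 4) (Fin 4) ℂ :=
  !![1, 0, 0, 0;
     1, 4 * c ^ 5, 0, 0;
     0, 0, 32 * c ^ 6, 0;
     0, 0, 32 * c ^ 6, 4 * c]

theorem gB_eq_smul_Umat_mulVec_fB (c x₀ x₁ x₂ : ℂ) :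
    gB ![x₀, c * x₁, x₀, 2 * c * x₂] =
      (c ^ 2 * x₀ ^ 2) • (Umat c).mulVec (fB ![x₀, x₁, x₂]) := by
  ext i
  fin_cases i <;>
    simp [gB, fB, Umat] <;> ring

theorem Umat_mulVec_fB_ne_zero (c : ℂ) {x₀ x₁ : ℂ} (x₂ : ℂ) (h₀ : x₀ ≠ 0) (h₁ : x₁ ≠ 0) :
    (Umat c).mulVec (fB ![x₀, x₁, x₂]) ≠ 0 := by
  intro h
  have h' := congrFun h 0
  simp [fB, Umat, Matrix.mulVec, dotProduct, Fin.sum_univ_four, h₀, h₁] at h'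

theorem stmt5 :
    (∀ c x₀ x₁ x₂ : ℂ,
      gB ![x₀, c * x₁, x₀, 2 * c * x₂] =
        (c ^ 2 * x₀ ^ 2) • (Umat c).mulVec (fB ![x₀, x₁, x₂])) ∧
    (∀ c x₀ x₁ x₂ : ℂ, c ≠ 0 → x₀ * x₁ * x₂ ≠ 0 →
      ∃ (h₁ : (Umat c).mulVec (fB ![x₀, x₁, x₂]) ≠ 0)
        (y : Fin 4 → ℂ) (h₂ : gB y ≠ 0),
        Projectivization.mk ℂ ((Umat c).mulVec (fB ![x₀, x₁, x₂])) h₁ =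
          Projectivization.mk ℂ (gB y) h₂) := by
  refine ⟨gB_eq_smul_Umat_mulVec_fB, fun c x₀ x₁ x₂ hc hx => ?_⟩
  have h₀ : x₀ ≠ 0 := left_ne_zero_of_mul (left_ne_zero_of_mul hx)
  have h₁ : x₁ ≠ 0 := right_ne_zero_of_mul (left_ne_zero_of_mul hx)
  have hU := Umat_mulVec_fB_ne_zero c x₂ h₀ h₁
  have hs : c ^ 2 * x₀ ^ 2 ≠ 0 := mul_ne_zero (pow_ne_zero 2 hc) (pow_ne_zero 2 h₀)
  have hg := gB_eq_smul_Umat_mulVec_fB c x₀ x₁ x₂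
  refine ⟨hU, _, hg ▸ smul_ne_zero hs hU, Eq.symm ?_⟩
  exact (Projectivization.mk_eq_mk_iff' ℂ _ _ _ _).2 ⟨_, hg.symm⟩
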